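/- (Integral 2 of the main Theorem, Euclidean case.) Let n ≥ 1 and V : ℝⁿ → ℝ smooth. Suppose L_a(q) and B_a(q) are smooth vector fields on ℝⁿ such that L_{(a,b)} and B_{(a,b)} (the symmetrized derivatives) are second-order Killing tensors of the Euclidean metric, and which satisfy ∂_a(L_b ∂_b V) = −2 L_{(a,b)} ∂_b V and ∂_a(B_b ∂_b V) = −2 B_{(a,b)} ∂_b V − 2 L_a. Then I₂ = −(t³/3) L_{(a,b)} q̇^a q̇^b + t² L_a q̇^a + (t³/3) L_a ∂_a V − t B_{(a,b)} q̇^a q̇^b + B_a q̇^a + t B_a ∂_a V is constant along every C² solution of q̈^a = −∂V/∂q^a. -/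

import Mathlib

open Real Set
open scoped ContDiff

/-- Partial derivative of a scalar field on `ℝⁿ` with respect to the `a`-th coordinate. -/
noncomputable def pd {n : ℕ} (f : (Fin n → ℝ) → ℝ) (q : Fin n → ℝ) (a : Fin n) : ℝ :=
  fderiv ℝ f q (Pi.single a 1)

/-- The symmetrized derivative `L_{(a,b)} = (∂_a L_b + ∂_b L_a)/2` of a vector field on `ℝⁿ`. -/
noncomputable def symD {n : ℕ} (L : (Fin n → ℝ) → Fin n → ℝ) (q : Fin n → ℝ) (a b : Fin n) : ℝ :=
  (pd (fun q => L q b) q a + pd (fun q => L q a) q b) / 2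

theorem contDiff_pd {n : ℕ} {f : (Fin n → ℝ) → ℝ} (hf : ContDiff ℝ ∞ f) (a : Fin n) :
    ContDiff ℝ ∞ (fun q => pd f q a) :=
  (hf.fderiv_right (m := ∞) le_rfl).clm_apply contDiff_const

theorem contDiff_symD {n : ℕ} {L : (Fin n → ℝ) → Fin n → ℝ}
    (hL : ∀ a, ContDiff ℝ ∞ (fun q => L q a)) (a b : Fin n) :
    ContDiff ℝ ∞ (fun q => symD L q a b) :=
  ((contDiff_pd (hL b) a).add (contDiff_pd (hL a) b)).div_const 2

theorem fderiv_apply_eq_sum_pd {n : ℕ} (f : (Fin n → ℝ) → ℝ) (x v : Fin n → ℝ) :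
    fderiv ℝ f x v = ∑ c, pd f x c * v c := by
  conv_lhs => rw [pi_eq_sum_univ' v]
  simp only [map_sum, map_smul, smul_eq_mul, pd]
  exact Finset.sum_congr rfl fun c _ => mul_comm _ _

/-- Chain rule along a curve, in coordinates. -/
theorem hasDerivAt_comp_curve {n : ℕ} {f : (Fin n → ℝ) → ℝ} (hf : ContDiff ℝ ∞ f)
    {q : ℝ → Fin n → ℝ} {v : Fin n → ℝ} {t : ℝ} (hq : HasDerivAt q v t) :
    HasDerivAt (fun s => f (q s)) (∑ c, pd f (q t) c * v c) t := by
  rw [← fderiv_apply_eq_sum_pd]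
  exact ((hf.differentiable (by simp)) (q t)).hasFDerivAt.comp_hasDerivAt t hq

/-- A three-index array whose cyclic symmetrization vanishes has vanishing cubic form. -/
theorem sum_cubic_eq_zero_of_cyclic {n : ℕ} (D : Fin n → Fin n → Fin n → ℝ) (v : Fin n → ℝ)
    (hD : ∀ a b c, D a b c + D b c a + D c a b = 0) :
    ∑ a, ∑ b, ∑ c, D a b c * v c * v a * v b = 0 := by
  have h1 : ∑ a, ∑ b, ∑ c, D b c a * v c * v a * v b
      = ∑ a, ∑ b, ∑ c, D a b c * v c * v a * v b := by
    rw [Finset.sum_comm]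
    refine Finset.sum_congr rfl fun b _ => ?_
    rw [Finset.sum_comm]
    refine Finset.sum_congr rfl fun c _ => Finset.sum_congr rfl fun a _ => by ring
  have h2 : ∑ a, ∑ b, ∑ c, D c a b * v c * v a * v b
      = ∑ a, ∑ b, ∑ c, D a b c * v c * v a * v b := by
    simp_rw [Finset.sum_comm (s := Finset.univ) (t := Finset.univ)
      (f := fun b c => D c _ b * v c * v _ * v b)]
    rw [Finset.sum_comm]
    refine Finset.sum_congr rfl fun c _ => Finset.sum_congr rfl fun a _ =>
      Finset.sum_congr rfl fun b _ => by ring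
  have h3 : ∑ a, ∑ b, ∑ c, (D a b c + D b c a + D c a b) * v c * v a * v b = 0 := by
    simp [hD]
  simp only [add_mul, Finset.sum_add_distrib, h1, h2] at h3
  linarith

theorem symD_comm {n : ℕ} (L : (Fin n → ℝ) → Fin n → ℝ) (q : Fin n → ℝ) (a b : Fin n) :
    symD L q a b = symD L q b a := by
  simp only [symD, add_comm]

/-- Along a curve with velocity `v` and acceleration `w`, the quadratic form of a Killing tensor
`L_{(a,b)}` varies only through the acceleration. -/
theorem hasDerivAt_symD_quadratic {n : ℕ} {L : (Fin n → ℝ) → Fin n → ℝ}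
    (hL : ∀ a, ContDiff ℝ ∞ (fun q => L q a))
    (hKT : ∀ q a b c,
      pd (fun q => symD L q a b) q c + pd (fun q => symD L q b c) q a
        + pd (fun q => symD L q c a) q b = 0)
    {q v : ℝ → Fin n → ℝ} {w : Fin n → ℝ} {t : ℝ}
    (hq : HasDerivAt q (v t) t) (hv : HasDerivAt v w t) :
    HasDerivAt (fun s => ∑ a, ∑ b, symD L (q s) a b * v s a * v s b)
      (2 * ∑ a, (∑ b, symD L (q t) a b * w b) * v t a) t := by
  have hva := hasDerivAt_pi.1 hv
  refine (HasDerivAt.fun_sum fun a _ => HasDerivAt.fun_sum fun b _ =>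
    ((hasDerivAt_comp_curve (contDiff_symD hL a b) hq).mul (hva a)).mul (hva b)).congr_deriv ?_
  have h0 := sum_cubic_eq_zero_of_cyclic
    (fun a b c => pd (fun q => symD L q a b) (q t) c) (v t) (hKT (q t))
  have hs : ∑ a, ∑ b, symD L (q t) a b * w a * v t b
      = ∑ a, ∑ b, symD L (q t) a b * w b * v t a := by
    rw [Finset.sum_comm]
    refine Finset.sum_congr rfl fun b _ => Finset.sum_congr rfl fun a _ => ?_
    rw [symD_comm]
  have hr : ∑ a, ∑ b, symD L (q t) a b * v t a * w b
      = ∑ a, ∑ b, symD L (q t) a b * w b * v t a :=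
    Finset.sum_congr rfl fun a _ => Finset.sum_congr rfl fun b _ => by ring
  simp only [add_mul, Finset.sum_mul, Finset.sum_add_distrib] at h0 ⊢
  simp only [Pi.mul_apply, h0, hs, hr]
  ring

theorem hasDerivAt_sum_mul_velocity {n : ℕ} {L : (Fin n → ℝ) → Fin n → ℝ}
    (hL : ∀ a, ContDiff ℝ ∞ (fun q => L q a))
    {q v : ℝ → Fin n → ℝ} {w : Fin n → ℝ} {t : ℝ}
    (hq : HasDerivAt q (v t) t) (hv : HasDerivAt v w t) :
    HasDerivAt (fun s => ∑ a, L (q s) a * v s a)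
      (∑ a, ∑ b, symD L (q t) a b * v t a * v t b + ∑ a, L (q t) a * w a) t := by
  have hva := hasDerivAt_pi.1 hv
  refine (HasDerivAt.fun_sum fun a _ =>
    (hasDerivAt_comp_curve (hL a) hq).mul (hva a)).congr_deriv ?_
  rw [Finset.sum_add_distrib]
  congr 1
  have hs : ∑ a, ∑ b, pd (fun q => L q b) (q t) a * v t a * v t b
      = ∑ a, ∑ b, pd (fun q => L q a) (q t) b * v t b * v t a := Finset.sum_comm
  have he : ∑ a, ∑ b, symD L (q t) a b * v t a * v t b
      = (∑ a, ∑ b, pd (fun q => L q b) (q t) a * v t a * v t b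
        + ∑ a, ∑ b, pd (fun q => L q a) (q t) b * v t b * v t a) / 2 := by
    simp only [← Finset.sum_add_distrib, Finset.sum_div]
    refine Finset.sum_congr rfl fun a _ => Finset.sum_congr rfl fun b _ => ?_
    simp only [symD]
    ring
  rw [he, hs]
  simp only [Finset.sum_mul]
  ring

/-- Integral 2 of the main Theorem (Euclidean case): given vector fields `L_a`, `B_a` whose
symmetrized derivatives are Killing tensors and which satisfy
`∂_a(L_b∂_bV) = −2L_{(a,b)}∂_bV` and `∂_a(B_b∂_bV) = −2B_{(a,b)}∂_bV − 2L_a`, the quantity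
`I₂ = −(t³/3)L_{(a,b)}q̇^aq̇^b + t²L_aq̇^a + (t³/3)L_a∂_aV − tB_{(a,b)}q̇^aq̇^b + B_aq̇^a
+ tB_a∂_aV` is constant along every C² solution of `q̈^a = −∂V/∂q^a`. -/
theorem stmt2 (n : ℕ) (hn : 1 ≤ n) (V : (Fin n → ℝ) → ℝ) (hV : ContDiff ℝ ∞ V)
    (L B : (Fin n → ℝ) → Fin n → ℝ)
    (hLsmooth : ∀ a, ContDiff ℝ ∞ (fun q => L q a))
    (hBsmooth : ∀ a, ContDiff ℝ ∞ (fun q => B q a))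
    (hLKT : ∀ q a b c,
      pd (fun q => symD L q a b) q c + pd (fun q => symD L q b c) q a
        + pd (fun q => symD L q c a) q b = 0)
    (hBKT : ∀ q a b c,
      pd (fun q => symD B q a b) q c + pd (fun q => symD B q b c) q a
        + pd (fun q => symD B q c a) q b = 0)
    (hLV : ∀ q a,
      pd (fun q => ∑ b, L q b * pd V q b) q a = -2 * ∑ b, symD L q a b * pd V q b)
    (hBV : ∀ q a,
      pd (fun q => ∑ b, B q b * pd V q b) q a
        = -2 * (∑ b, symD B q a b * pd V q b) - 2 * L q a)
    (aJ bJ : ℝ) (q q' q'' : ℝ → Fin n → ℝ)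
    (hq : ∀ t ∈ Ioo aJ bJ, HasDerivAt q (q' t) t)
    (hq' : ∀ t ∈ Ioo aJ bJ, HasDerivAt q' (q'' t) t)
    (heq : ∀ t ∈ Ioo aJ bJ, ∀ a, q'' t a = -pd V (q t) a) :
    ∀ t₁ ∈ Ioo aJ bJ, ∀ t₂ ∈ Ioo aJ bJ,
      -(t₁^3 / 3) * (∑ a, ∑ b, symD L (q t₁) a b * q' t₁ a * q' t₁ b)
        + t₁^2 * (∑ a, L (q t₁) a * q' t₁ a)
        + t₁^3 / 3 * (∑ a, L (q t₁) a * pd V (q t₁) a)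
        - t₁ * (∑ a, ∑ b, symD B (q t₁) a b * q' t₁ a * q' t₁ b)
        + (∑ a, B (q t₁) a * q' t₁ a)
        + t₁ * (∑ a, B (q t₁) a * pd V (q t₁) a)
      = -(t₂^3 / 3) * (∑ a, ∑ b, symD L (q t₂) a b * q' t₂ a * q' t₂ b)
        + t₂^2 * (∑ a, L (q t₂) a * q' t₂ a)
        + t₂^3 / 3 * (∑ a, L (q t₂) a * pd V (q t₂) a)
        - t₂ * (∑ a, ∑ b, symD B (q t₂) a b * q' t₂ a * q' t₂ b)
        + (∑ a, B (q t₂) a * q' t₂ a)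
        + t₂ * (∑ a, B (q t₂) a * pd V (q t₂) a) := by
  have hLq : ContDiff ℝ ∞ (fun q => ∑ b, L q b * pd V q b) :=
    ContDiff.sum fun b _ => (hLsmooth b).mul (contDiff_pd hV b)
  have hBq : ContDiff ℝ ∞ (fun q => ∑ b, B q b * pd V q b) :=
    ContDiff.sum fun b _ => (hBsmooth b).mul (contDiff_pd hV b)
  have key : ∀ t ∈ Ioo aJ bJ, HasDerivAt
      (fun t => -(t^3 / 3) * (∑ a, ∑ b, symD L (q t) a b * q' t a * q' t b)
        + t^2 * (∑ a, L (q t) a * q' t a)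
        + t^3 / 3 * (∑ a, L (q t) a * pd V (q t) a)
        - t * (∑ a, ∑ b, symD B (q t) a b * q' t a * q' t b)
        + (∑ a, B (q t) a * q' t a)
        + t * (∑ a, B (q t) a * pd V (q t) a)) 0 t := by
    intro t ht
    have h3 : HasDerivAt (fun t : ℝ => t^3 / 3) (t^2) t :=
      ((hasDerivAt_pow 3 t).div_const 3).congr_deriv (by norm_num)
    have h2 : HasDerivAt (fun t : ℝ => t^2) (2 * t) t := by
      simpa using hasDerivAt_pow 2 t
    refine ((((((h3.neg.mul (hasDerivAt_symD_quadratic hLsmooth hLKT (hq t ht) (hq' t ht))).add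
      (h2.mul (hasDerivAt_sum_mul_velocity hLsmooth (hq t ht) (hq' t ht)))).add
      (h3.mul (hasDerivAt_comp_curve hLq (hq t ht)))).sub
      ((hasDerivAt_id t).mul
        (hasDerivAt_symD_quadratic hBsmooth hBKT (hq t ht) (hq' t ht)))).add
      (hasDerivAt_sum_mul_velocity hBsmooth (hq t ht) (hq' t ht))).add
      ((hasDerivAt_id t).mul (hasDerivAt_comp_curve hBq (hq t ht)))).congr_deriv ?_
    simp only [hLV, hBV, heq t ht, mul_neg, Finset.sum_neg_distrib, neg_mul, sub_mul,
      Finset.sum_sub_distrib, mul_assoc, ← Finset.mul_sum, id, Pi.neg_apply]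
    ring
  intro t₁ ht₁ t₂ ht₂
  exact isOpen_Ioo.is_const_of_deriv_eq_zero isPreconnected_Ioo
    (fun t ht => (key t ht).differentiableAt.differentiableWithinAt)
    (fun t ht => (key t ht).deriv) ht₁ ht₂
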